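/- arXiv:1805.10791 — 6 statements merged into one kernel-verified Lean document; each statement's English description precedes it below -/
import Mathlib

section
/- Let f : [−1,1] → ℝ be a continuous even function and let K ≥ 1 be an even integer. Define δ_K(f) = inf over all real polynomials G of degree at most K of sup_{x ∈ [−1,1]} |f(x) − G(x)|. Then there exist two Borel probability measures μ̃₀ and μ̃₁ on [−1,1] such that: (i) μ̃₀ and μ̃₁ are symmetric about 0 (invariant under t ↦ −t); (ii) ∫ t^l dμ̃₀(t) = ∫ t^l dμ̃₁(t) for all l = 0, 1, …, K; and (iii) ∫ f(t) dμ̃₁(t) − ∫ f(t) dμ̃₀(t) = 2 δ_K(f). -/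
open MeasureTheory Polynomial

/-- In a finite-dimensional real space, the convex hull of a compact set is compact. -/
theorem isCompact_convexHull_of_finiteDimensional {E : Type*} [NormedAddCommGroup E]
    [NormedSpace ℝ E] [FiniteDimensional ℝ E] {s : Set E} (hs : IsCompact s) :
    IsCompact (convexHull ℝ s) := by
  classical
  let n := Module.finrank ℝ E
  let Φ : (Fin (n + 1) → ℝ) × (Fin (n + 1) → E) → E := fun p => ∑ i, p.1 i • p.2 i
  have hΦ : Continuous Φ := by fun_prop
  have himage : convexHull ℝ s =
      Φ '' (stdSimplex ℝ (Fin (n + 1)) ×ˢ Set.univ.pi fun _ => s) := by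
    apply Set.Subset.antisymm
    · intro x hx
      rw [convexHull_eq_union] at hx
      simp only [Set.mem_iUnion] at hx
      obtain ⟨t, hts, hind, hxt⟩ := hx
      have hne : Nonempty t := by
        have := convexHull_nonempty_iff.1 ⟨x, hxt⟩
        exact this.to_subtype
      have hcard : Fintype.card t ≤ Fintype.card (Fin (n + 1)) := by
        rw [Fintype.card_fin]
        refine hind.card_le_finrank_succ.trans ?_
        gcongr
        exact Submodule.finrank_le _
      obtain ⟨e⟩ := Function.Embedding.nonempty_of_card_le hcard
      let z : Fin (n + 1) → E := fun i => (Function.invFun e i : t)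
      have hz : Set.range z = t := by
        have h1 : Function.Surjective (Function.invFun e) :=
          Function.invFun_surjective e.injective
        have h2 : z = ((↑) : t → E) ∘ Function.invFun e := rfl
        rw [h2, h1.range_comp, Subtype.range_coe_subtype]
        rfl
      have hzhull : convexHull ℝ (Set.range z) =
          Fintype.linearCombination ℝ z '' stdSimplex ℝ (Fin (n + 1)) := by
        rw [← convexHull_rangle_single_eq_stdSimplex, LinearMap.image_convexHull,
          ← Set.range_comp]
        congr 2
        ext i
        simp [Fintype.linearCombination_apply_single]
      rw [← hz, hzhull] at hxt
      obtain ⟨w, hw, rfl⟩ := hxt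
      refine ⟨(w, z), ⟨hw, fun i _ => hts ?_⟩, ?_⟩
      · rw [← hz]; exact Set.mem_range_self i
      · simp [Φ, Fintype.linearCombination_apply]
    · rintro _ ⟨⟨w, z⟩, ⟨hw, hz⟩, rfl⟩
      exact mem_convexHull_of_exists_fintype w z hw.1 hw.2 (fun i => hz i trivial) rfl
  rw [himage]
  exact ((isCompact_stdSimplex ℝ _).prod (isCompact_univ_pi fun _ => hs)).image hΦ

/-- The symmetrization about `0` of the discrete measure with weights `w` at the points `x`. -/
noncomputable def symmetrizedDiscreteMeasure {ι : Type*} [Fintype ι] (w x : ι → ℝ) : Measure ℝ :=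
  ∑ i, ENNReal.ofReal (w i / 2) • (Measure.dirac (x i) + Measure.dirac (-x i))

namespace symmetrizedDiscreteMeasure

variable {ι : Type*} [Fintype ι] {w x : ι → ℝ}

theorem isProbabilityMeasure (hw : ∀ i, 0 ≤ w i) (hw1 : ∑ i, w i = 1) :
    IsProbabilityMeasure (symmetrizedDiscreteMeasure w x) := by
  constructor
  have h : ∀ i, ENNReal.ofReal (w i / 2) * (1 + 1) = ENNReal.ofReal (w i) := fun i => by
    rw [mul_add, mul_one, ← ENNReal.ofReal_add (by linarith [hw i]) (by linarith [hw i]),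
      add_halves]
  simp only [symmetrizedDiscreteMeasure, Measure.coe_finsetSum, Finset.sum_apply,
    Measure.smul_apply, Measure.add_apply, measure_univ, smul_eq_mul, h]
  rw [← ENNReal.ofReal_sum_of_nonneg fun i _ => hw i, hw1, ENNReal.ofReal_one]

theorem compl_Icc_eq_zero (hx : ∀ i, x i ∈ Set.Icc (-1 : ℝ) 1) :
    symmetrizedDiscreteMeasure w x (Set.Icc (-1 : ℝ) 1)ᶜ = 0 := by
  simp only [symmetrizedDiscreteMeasure, Measure.coe_finsetSum, Finset.sum_apply,
    Measure.smul_apply, Measure.add_apply, smul_eq_mul]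
  refine Finset.sum_eq_zero fun i _ => ?_
  have hneg : -x i ∈ Set.Icc (-1 : ℝ) 1 := ⟨by linarith [(hx i).2], by linarith [(hx i).1]⟩
  rw [Measure.dirac_apply' _ measurableSet_Icc.compl,
    Measure.dirac_apply' _ measurableSet_Icc.compl]
  simp only [Set.indicator_of_notMem (Set.notMem_compl_iff.2 (hx i)),
    Set.indicator_of_notMem (Set.notMem_compl_iff.2 hneg), add_zero, mul_zero]

theorem map_neg :
    Measure.map (fun t : ℝ => -t) (symmetrizedDiscreteMeasure w x) =
      symmetrizedDiscreteMeasure w x := by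
  rw [symmetrizedDiscreteMeasure, Measure.map_finset_sum measurable_neg.aemeasurable]
  refine Finset.sum_congr rfl fun i _ => ?_
  rw [Measure.map_smul, Measure.map_add _ _ measurable_neg, Measure.map_dirac' measurable_neg,
    Measure.map_dirac' measurable_neg, neg_neg, add_comm]

theorem integral_eq_sum (hw : ∀ i, 0 ≤ w i) (g : ℝ → ℝ) :
    ∫ t, g t ∂symmetrizedDiscreteMeasure w x = ∑ i, w i * ((g (x i) + g (-x i)) / 2) := by
  have hg : ∀ a, Integrable g (Measure.dirac a) := fun a => integrable_dirac (by simp)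
  rw [symmetrizedDiscreteMeasure, integral_finsetSum_measure fun i _ =>
    ((hg _).add_measure (hg _)).smul_measure ENNReal.ofReal_ne_top]
  refine Finset.sum_congr rfl fun i _ => ?_
  rw [integral_smul_measure, integral_add_measure (hg _) (hg _), integral_dirac,
    integral_dirac, ENNReal.toReal_ofReal (by linarith [hw i]), smul_eq_mul]
  ring

end symmetrizedDiscreteMeasure

/-- A function on `[-1, 1]` whose sum with a polynomial of degree at most `K` oscillates by at
most `2 * r` is within `r` of the polynomials of degree at most `K`. -/
theorem iInf_iSup_abs_sub_eval_le {f : ℝ → ℝ} {K : ℕ} {P : Polynomial ℝ} (hP : P.natDegree ≤ K)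
    {r m : ℝ} (hlow : ∀ x ∈ Set.Icc (-1 : ℝ) 1, m ≤ f x + P.eval x)
    (hupp : ∀ x ∈ Set.Icc (-1 : ℝ) 1, f x + P.eval x ≤ m + 2 * r) :
    ⨅ G : {G : Polynomial ℝ // G.natDegree ≤ K},
      ⨆ x : Set.Icc (-1 : ℝ) 1, |f x.1 - Polynomial.eval x.1 G.1| ≤ r := by
  have hdeg : (C (m + r) - P).natDegree ≤ K :=
    (natDegree_sub_le _ _).trans (by simpa using hP)
  have hbdd : BddBelow (Set.range fun G : {G : Polynomial ℝ // G.natDegree ≤ K} =>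
      ⨆ x : Set.Icc (-1 : ℝ) 1, |f x.1 - Polynomial.eval x.1 G.1|) :=
    ⟨0, by rintro _ ⟨G, rfl⟩; exact Real.iSup_nonneg fun x => abs_nonneg _⟩
  refine (ciInf_le hbdd ⟨C (m + r) - P, hdeg⟩).trans ?_
  have : Nonempty (Set.Icc (-1 : ℝ) 1) := ⟨⟨0, by norm_num⟩⟩
  refine ciSup_le fun x => ?_
  have h1 := hlow x x.2
  have h2 := hupp x x.2
  rw [abs_le]
  simp only [eval_sub, eval_C]
  constructor <;> linarith

/-- The image of `[-1, 1]` under the moment curve of order `K`, extended by the value of `f`. -/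
def momentCurve (f : ℝ → ℝ) (K : ℕ) : Set ((Fin (K + 1) → ℝ) × ℝ) :=
  (fun t : ℝ => ((fun i : Fin (K + 1) => t ^ (i : ℕ)), f t)) '' Set.Icc (-1 : ℝ) 1

theorem isCompact_momentCurve {f : ℝ → ℝ} (hf : ContinuousOn f (Set.Icc (-1 : ℝ) 1)) (K : ℕ) :
    IsCompact (momentCurve f K) :=
  isCompact_Icc.image_of_continuousOn (ContinuousOn.prodMk (by fun_prop) hf)

open scoped Pointwise in
/-- Twice the distance from `f` to the polynomials of degree at most `K` is the difference of the
last coordinates of two points of the convex hull of the moment curve whose other coordinates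
agree. -/
theorem two_mul_iInf_mem_convexHull_momentCurve_sub {f : ℝ → ℝ}
    (hf : ContinuousOn f (Set.Icc (-1 : ℝ) 1)) (K : ℕ) :
    ((0, 2 * ⨅ G : {G : Polynomial ℝ // G.natDegree ≤ K},
        ⨆ x : Set.Icc (-1 : ℝ) 1, |f x.1 - Polynomial.eval x.1 G.1|) :
      (Fin (K + 1) → ℝ) × ℝ) ∈
      convexHull ℝ (momentCurve f K) - convexHull ℝ (momentCurve f K) := by
  set δ := ⨅ G : {G : Polynomial ℝ // G.natDegree ≤ K},
    ⨆ x : Set.Icc (-1 : ℝ) 1, |f x.1 - Polynomial.eval x.1 G.1|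
  have hδ0 : 0 ≤ δ := Real.iInf_nonneg fun G => Real.iSup_nonneg fun x => abs_nonneg _
  by_contra hnot
  have hcompact := isCompact_convexHull_of_finiteDimensional (isCompact_momentCurve hf K)
  obtain ⟨L, u, hLu, huL⟩ := geometric_hahn_banach_closed_point
    ((convex_convexHull ℝ (momentCurve f K)).sub (convex_convexHull ℝ (momentCurve f K)))
    (sub_eq_add_neg (convexHull ℝ (momentCurve f K)) _ ▸ (hcompact.add hcompact.neg).isClosed) hnot
  let c : Fin (K + 1) → ℝ := fun i => L (Pi.single i 1, 0)
  let a : ℝ := L (0, 1)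
  have hL : ∀ (v : Fin (K + 1) → ℝ) (y : ℝ), L (v, y) = ∑ i, c i * v i + a * y := by
    intro v y
    have hv : (v, y) = ∑ i, v i • ((Pi.single i 1, 0) : (Fin (K + 1) → ℝ) × ℝ) +
        y • ((0, 1) : (Fin (K + 1) → ℝ) × ℝ) := by
      ext j
      · simp [Prod.fst_sum, Finset.sum_apply, Pi.single_apply]
      · simp [Prod.snd_sum]
    rw [hv, map_add, map_sum]
    simp only [map_smul, smul_eq_mul]
    congr 1
    · exact Finset.sum_congr rfl fun i _ => mul_comm _ _
    · exact mul_comm _ _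
  have hdiff : ∀ x ∈ Set.Icc (-1 : ℝ) 1, ∀ y ∈ Set.Icc (-1 : ℝ) 1,
      (∑ i : Fin (K + 1), c i * x ^ (i : ℕ) + a * f x) -
        (∑ i : Fin (K + 1), c i * y ^ (i : ℕ) + a * f y) < u := by
    intro x hx y hy
    have := hLu _ (Set.sub_mem_sub (subset_convexHull ℝ _ (Set.mem_image_of_mem _ hx))
      (subset_convexHull ℝ _ (Set.mem_image_of_mem _ hy)))
    rwa [map_sub, hL, hL] at this
  have hzero : (0 : ℝ) ∈ Set.Icc (-1 : ℝ) 1 := by norm_num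
  have hu : 0 < u := by simpa using hdiff 0 hzero 0 hzero
  have huδ : u < a * (2 * δ) := by simpa [hL] using huL
  have ha : 0 < a := by
    by_contra! h
    nlinarith [mul_nonneg (neg_nonneg.2 h) hδ0]
  let P : Polynomial ℝ := ∑ i : Fin (K + 1), C (c i / a) * X ^ (i : ℕ)
  have hPdeg : P.natDegree ≤ K := natDegree_sum_le_of_forall_le _ _ fun i _ =>
    (natDegree_C_mul_X_pow_le _ _).trans (Nat.lt_succ_iff.1 i.2)
  have hPeval : ∀ x, ∑ i : Fin (K + 1), c i * x ^ (i : ℕ) + a * f x = a * (f x + P.eval x) := by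
    intro x
    simp only [P, eval_finsetSum, eval_mul, eval_C, eval_pow, eval_X, mul_add, Finset.mul_sum]
    rw [add_comm]
    congr 1
    refine Finset.sum_congr rfl fun i _ => ?_
    field_simp
  obtain ⟨y, hy, hmin⟩ := isCompact_Icc.exists_isMinOn ⟨0, hzero⟩
    (hf.add P.continuous.continuousOn)
  have hle : δ ≤ u / a / 2 := by
    refine iInf_iSup_abs_sub_eval_le hPdeg (m := f y + P.eval y) (fun x hx => hmin hx)
      fun x hx => ?_
    have h := hdiff x hx y hy
    rw [hPeval, hPeval, ← mul_sub, mul_comm, ← lt_div_iff₀ ha] at h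
    linarith
  have : u / a < 2 * δ := by rwa [div_lt_iff₀ ha, mul_comm]
  linarith

/-- A point of the convex hull of the moment curve records the moments and the integral of `f`
for some discrete probability measure on `[-1, 1]`. -/
theorem exists_weights_of_mem_convexHull_momentCurve {f : ℝ → ℝ} {K : ℕ}
    {p : (Fin (K + 1) → ℝ) × ℝ} (hp : p ∈ convexHull ℝ (momentCurve f K)) :
    ∃ (ι : Type) (_ : Fintype ι) (w x : ι → ℝ), (∀ i, 0 ≤ w i) ∧ ∑ i, w i = 1 ∧
      (∀ i, x i ∈ Set.Icc (-1 : ℝ) 1) ∧ (∀ j : Fin (K + 1), ∑ i, w i * x i ^ (j : ℕ) = p.1 j) ∧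
      ∑ i, w i * f (x i) = p.2 := by
  obtain ⟨ι, hι, w, z, hw, hw1, hz, rfl⟩ := mem_convexHull_iff_exists_fintype.1 hp
  choose x hx hxz using hz
  obtain rfl : _ = z := funext hxz
  exact ⟨ι, hι, w, x, hw, hw1, hx, fun j => by simp [Prod.fst_sum, Finset.sum_apply],
    by simp [Prod.snd_sum]⟩

/-- Proposition 1 (moment matching and best polynomial approximation). Let
`f : [−1,1] → ℝ` be continuous and even and let `K ≥ 1` be an even integer. With
`δ_K(f) = inf_{deg G ≤ K} sup_{x ∈ [−1,1]} |f(x) − G(x)|`, there exist Borel probability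
measures `μ̃₀, μ̃₁` on `[−1,1]`, symmetric about `0`, whose moments of orders
`0, 1, …, K` coincide, and with `∫ f dμ̃₁ − ∫ f dμ̃₀ = 2 δ_K(f)`. -/
theorem moment_matching_best_approximation (f : ℝ → ℝ)
    (hf : ContinuousOn f (Set.Icc (-1 : ℝ) 1)) (heven : ∀ x : ℝ, f (-x) = f x)
    (K : ℕ) (hK1 : 1 ≤ K) (hKeven : Even K) :
    ∃ μ0 μ1 : Measure ℝ, IsProbabilityMeasure μ0 ∧ IsProbabilityMeasure μ1 ∧
      μ0 (Set.Icc (-1 : ℝ) 1)ᶜ = 0 ∧ μ1 (Set.Icc (-1 : ℝ) 1)ᶜ = 0 ∧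
      Measure.map (fun t : ℝ => -t) μ0 = μ0 ∧ Measure.map (fun t : ℝ => -t) μ1 = μ1 ∧
      (∀ l : ℕ, l ≤ K → ∫ t, t ^ l ∂μ0 = ∫ t, t ^ l ∂μ1) ∧
      (∫ t, f t ∂μ1) - (∫ t, f t ∂μ0) =
        2 * ⨅ G : {G : Polynomial ℝ // G.natDegree ≤ K},
              ⨆ x : Set.Icc (-1 : ℝ) 1, |f x.1 - Polynomial.eval x.1 G.1| := by
  obtain ⟨p, hp, q, hq, hpq⟩ :=
    Set.mem_sub.1 (two_mul_iInf_mem_convexHull_momentCurve_sub hf K)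
  obtain ⟨ι, _, w, x, hw, hw1, hx, hmom, hval⟩ := exists_weights_of_mem_convexHull_momentCurve hp
  obtain ⟨κ, _, v, y, hv, hv1, hy, hmom', hval'⟩ :=
    exists_weights_of_mem_convexHull_momentCurve hq
  refine ⟨symmetrizedDiscreteMeasure v y, symmetrizedDiscreteMeasure w x,
    symmetrizedDiscreteMeasure.isProbabilityMeasure hv hv1,
    symmetrizedDiscreteMeasure.isProbabilityMeasure hw hw1,
    symmetrizedDiscreteMeasure.compl_Icc_eq_zero hy,
    symmetrizedDiscreteMeasure.compl_Icc_eq_zero hx,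
    symmetrizedDiscreteMeasure.map_neg, symmetrizedDiscreteMeasure.map_neg, fun l hl => ?_, ?_⟩
  · have hpow : ∀ s t : ℝ, s * ((t ^ l + (-t) ^ l) / 2) = (1 + (-1) ^ l) / 2 * (s * t ^ l) := by
      intro s t
      rw [neg_pow]
      ring
    have h : p.1 ⟨l, by omega⟩ - q.1 ⟨l, by omega⟩ = 0 :=
      congrFun (congrArg Prod.fst hpq) ⟨l, by omega⟩
    rw [symmetrizedDiscreteMeasure.integral_eq_sum hv,
      symmetrizedDiscreteMeasure.integral_eq_sum hw]
    simp only [hpow, ← Finset.mul_sum]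
    rw [← hmom, ← hmom', sub_eq_zero] at h
    rw [← h]
  · rw [symmetrizedDiscreteMeasure.integral_eq_sum hv,
      symmetrizedDiscreteMeasure.integral_eq_sum hw]
    simp only [heven, add_self_div_two]
    rw [hval, hval']
    exact congrArg Prod.snd hpq
end

section
/- Let γ > 0 and let K ≥ 1 be an integer. Let P be a polynomial of degree at most 2K that attains the infimum of sup_{x ∈ [−1,1]} | |x|^γ − G(x) | over all real polynomials G of degree at most 2K. Then there exists a constant C > 0 depending only on γ such that every coefficient a_j of P (j = 0, 1, …, 2K) satisfies |a_j| ≤ C · 6^K. -/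
open Polynomial

namespace Polynomial.Chebyshev

open MeasureTheory Real

/-- Every polynomial of degree at most `n` is a combination of `T 0, …, T n`. -/
theorem exists_eq_sum_C_mul_T (n : ℕ) (P : ℝ[X]) (hP : P.natDegree ≤ n) :
    ∃ c : ℕ → ℝ, P = ∑ k ∈ Finset.range (n + 1), Polynomial.C (c k) * T ℝ (k : ℤ) := by
  induction n generalizing P with
  | zero =>
    refine ⟨fun _ => P.coeff 0, ?_⟩
    simpa using eq_C_of_natDegree_le_zero hP
  | succ n ih =>
    have hdeg : (T ℝ ((n + 1 : ℕ) : ℤ)).natDegree = n + 1 := by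
      rw [natDegree_T, Int.natAbs_natCast]
    have hne : (T ℝ ((n + 1 : ℕ) : ℤ)).coeff (n + 1) ≠ 0 := by
      have h := leadingCoeff_ne_zero.mpr (T_ne_zero ℝ ((n + 1 : ℕ) : ℤ))
      rwa [leadingCoeff, hdeg] at h
    set a := P.coeff (n + 1) / (T ℝ ((n + 1 : ℕ) : ℤ)).coeff (n + 1) with ha
    obtain ⟨c, hc⟩ := ih (P - Polynomial.C a * T ℝ ((n + 1 : ℕ) : ℤ)) (by
      rw [natDegree_le_iff_coeff_eq_zero]
      intro N hN
      rw [coeff_sub, coeff_C_mul]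
      rcases eq_or_lt_of_le (Nat.succ_le_of_lt hN) with rfl | h
      · rw [ha, Nat.succ_eq_add_one, div_mul_cancel₀ _ hne, sub_self]
      · rw [coeff_eq_zero_of_natDegree_lt (hP.trans_lt h),
          coeff_eq_zero_of_natDegree_lt (hdeg.trans_lt h), mul_zero, sub_zero])
    refine ⟨Function.update c (n + 1) a, ?_⟩
    rw [Finset.sum_range_succ, Function.update_self]
    have : ∑ k ∈ Finset.range (n + 1), Polynomial.C (Function.update c (n + 1) a k) * T ℝ (k : ℤ)
        = ∑ k ∈ Finset.range (n + 1), Polynomial.C (c k) * T ℝ (k : ℤ) := by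
      refine Finset.sum_congr rfl fun k hk => ?_
      rw [Function.update_of_ne (Finset.mem_range.mp hk).ne]
    rw [this, ← hc, sub_add_cancel]

/-- The Chebyshev coefficients of a polynomial bounded by `M` on `[-1, 1]` are at most `2 * M`. -/
theorem abs_le_of_eq_sum_C_mul_T {n : ℕ} {P : ℝ[X]} {c : ℕ → ℝ} {M : ℝ}
    (hP : P = ∑ k ∈ Finset.range (n + 1), Polynomial.C (c k) * T ℝ (k : ℤ))
    (hM : ∀ x ∈ Set.Icc (-1 : ℝ) 1, |P.eval x| ≤ M) {m : ℕ} (hm : m ≤ n) :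
    |c m| ≤ 2 * M := by
  have hint (Q : ℝ[X]) : Integrable (fun x => Q.eval x) measureT :=
    integrable_measureT Q.continuous.continuousOn
  have hsum : ∫ x, P.eval x * (T ℝ (m : ℤ)).eval x ∂measureT
      = c m * ∫ x, (T ℝ (m : ℤ)).eval x * (T ℝ (m : ℤ)).eval x ∂measureT := by
    have h : ∀ x, P.eval x * (T ℝ (m : ℤ)).eval x = ∑ k ∈ Finset.range (n + 1),
        c k * ((T ℝ (k : ℤ)).eval x * (T ℝ (m : ℤ)).eval x) := by
      intro x
      rw [hP, eval_finsetSum, Finset.sum_mul]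
      simp [mul_assoc]
    simp_rw [h]
    rw [integral_finsetSum]
    · simp_rw [integral_const_mul]
      rw [Finset.sum_eq_single m]
      · intro k _ hk
        rw [integral_eval_T_real_mul_eval_T_real_measureT_of_ne hk, mul_zero]
      · intro h
        exact absurd (Finset.mem_range.mpr (by omega)) h
    · intro k _
      simpa using (hint (T ℝ (k : ℤ) * T ℝ (m : ℤ))).const_mul (c k)
  have hbound : |∫ x, P.eval x * (T ℝ (m : ℤ)).eval x ∂measureT| ≤ M * π := by
    rw [integral_measureT_eq_integral_cos]
    have := intervalIntegral.norm_integral_le_of_norm_le_const (a := 0) (b := π) (C := M)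
      (f := fun θ => P.eval (cos θ) * (T ℝ (m : ℤ)).eval (cos θ)) (by
        intro θ _
        have h1 := hM (cos θ) ⟨neg_one_le_cos θ, cos_le_one θ⟩
        rw [T_real_cos, Real.norm_eq_abs, abs_mul]
        have h2 := abs_cos_le_one ((m : ℤ) * θ)
        nlinarith [abs_nonneg (P.eval (cos θ))])
    simpa [abs_of_pos pi_pos] using this
  have hnorm : π / 2 ≤ ∫ x, (T ℝ (m : ℤ)).eval x * (T ℝ (m : ℤ)).eval x ∂measureT := by
    rcases eq_or_ne m 0 with rfl | h0
    · have := integral_eval_T_real_mul_self_measureT_zero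
      simp only [Nat.cast_zero, this]
      linarith [pi_pos]
    · rw [integral_T_real_mul_self_measureT_of_ne_zero h0]
  rw [hsum, abs_mul, abs_of_pos (lt_of_lt_of_le (by positivity) hnorm)] at hbound
  have h := (mul_le_mul_of_nonneg_left hnorm (abs_nonneg (c m))).trans hbound
  have : |c m| * π ≤ (2 * M) * π := by linarith
  exact le_of_mul_le_mul_right this pi_pos

theorem abs_coeff_T_le_pow {r : ℝ} (hr : 1 ≤ r) (hr2 : 2 * r + 1 ≤ r ^ 2) (n j : ℕ) :
    |(T ℝ (n : ℤ)).coeff j| ≤ r ^ n := by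
  induction n using Nat.twoStepInduction generalizing j with
  | zero =>
    simp only [Nat.cast_zero, T_zero, coeff_one, pow_zero]
    split_ifs <;> simp
  | one =>
    simp only [Nat.cast_one, T_one, coeff_X, pow_one]
    split_ifs
    · simpa using hr
    · simpa using zero_le_one.trans hr
  | more n ih₀ ih₁ =>
    have hstep : ∀ a : ℝ, |a| ≤ r ^ (n + 1) →
        |2 * a - (T ℝ (n : ℤ)).coeff j| ≤ r ^ (n + 2) := by
      intro a ha
      have h0 : 0 ≤ r ^ n := by positivity
      calc |2 * a - (T ℝ (n : ℤ)).coeff j| ≤ |2 * a| + |(T ℝ (n : ℤ)).coeff j| := abs_sub _ _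
        _ ≤ 2 * r ^ (n + 1) + r ^ n := by
          rw [abs_mul, abs_two]
          linarith [ih₀ j]
        _ = (2 * r + 1) * r ^ n := by ring
        _ ≤ r ^ 2 * r ^ n := mul_le_mul_of_nonneg_right hr2 h0
        _ = r ^ (n + 2) := by ring
    have hrec : T ℝ ((n + 2 : ℕ) : ℤ)
        = Polynomial.C 2 * (X * T ℝ ((n + 1 : ℕ) : ℤ)) - T ℝ (n : ℤ) := by
      push_cast
      rw [T_add_two, ← mul_assoc]
      rfl
    rw [hrec, coeff_sub, coeff_C_mul]
    cases j with
    | zero => exact hstep _ (by rw [coeff_X_mul_zero, abs_zero]; positivity)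
    | succ j => exact hstep _ (by rw [coeff_X_mul]; exact ih₁ j)

/-- Coefficient bound for a polynomial of degree at most `n` bounded by `M` on `[-1, 1]`. -/
theorem abs_coeff_le_of_forall_abs_eval_le {r : ℝ} (hr : 1 ≤ r) (hr2 : 2 * r + 1 ≤ r ^ 2)
    {n : ℕ} {P : ℝ[X]} {M : ℝ} (hP : P.natDegree ≤ n)
    (hM : ∀ x ∈ Set.Icc (-1 : ℝ) 1, |P.eval x| ≤ M) (j : ℕ) :
    |P.coeff j| ≤ 2 * M * ∑ k ∈ Finset.range (n + 1), r ^ k := by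
  obtain ⟨c, hc⟩ := exists_eq_sum_C_mul_T n P hP
  have hM0 : 0 ≤ M := (abs_nonneg _).trans (hM 0 (by simp))
  calc |P.coeff j| = |∑ k ∈ Finset.range (n + 1), c k * (T ℝ (k : ℤ)).coeff j| := by
        conv_lhs => rw [hc]
        simp [finsetSum_coeff]
    _ ≤ ∑ k ∈ Finset.range (n + 1), |c k * (T ℝ (k : ℤ)).coeff j| :=
        Finset.abs_sum_le_sum_abs _ _
    _ ≤ ∑ k ∈ Finset.range (n + 1), 2 * M * r ^ k := by
        refine Finset.sum_le_sum fun k hk => ?_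
        rw [abs_mul]
        have hk' : k ≤ n := Nat.lt_succ_iff.mp (Finset.mem_range.mp hk)
        exact mul_le_mul (abs_le_of_eq_sum_C_mul_T hc hM hk') (abs_coeff_T_le_pow hr hr2 k j)
          (abs_nonneg _) (by positivity)
    _ = 2 * M * ∑ k ∈ Finset.range (n + 1), r ^ k := by rw [Finset.mul_sum]

end Polynomial.Chebyshev

/-- A best approximation of `|x| ^ γ` is bounded by `2` on `[-1, 1]`, by comparison with `0`. -/
theorem abs_eval_le_two_of_best_approx_abs_rpow {γ : ℝ} (hγ : 0 < γ) {n : ℕ} {P : ℝ[X]}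
    (h : (⨆ x : Set.Icc (-1 : ℝ) 1, |(|x.1| ^ γ) - P.eval x.1|) =
      ⨅ G : {G : ℝ[X] // G.natDegree ≤ n},
        ⨆ x : Set.Icc (-1 : ℝ) 1, |(|x.1| ^ γ) - G.1.eval x.1|)
    (x : ℝ) (hx : x ∈ Set.Icc (-1 : ℝ) 1) : |P.eval x| ≤ 2 := by
  have hpow : ∀ y ∈ Set.Icc (-1 : ℝ) 1, |(|y| ^ γ)| ≤ 1 := by
    intro y hy
    rw [abs_of_nonneg (Real.rpow_nonneg (abs_nonneg y) γ)]
    exact Real.rpow_le_one (abs_nonneg y) (abs_le.mpr hy) hγ.le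
  have hbdd : BddAbove (Set.range fun y : Set.Icc (-1 : ℝ) 1 => |(|y.1| ^ γ) - P.eval y.1|) := by
    refine isCompact_range ?_ |>.bddAbove
    have : Continuous fun y : ℝ => |y| ^ γ := continuous_abs.rpow_const fun _ => Or.inr hγ.le
    exact ((this.sub P.continuous).abs).comp continuous_subtype_val
  have hle : (⨆ y : Set.Icc (-1 : ℝ) 1, |(|y.1| ^ γ) - P.eval y.1|) ≤ 1 := by
    rw [h]
    refine (ciInf_le ⟨0, ?_⟩ ⟨0, by simp⟩).trans ?_
    · rintro _ ⟨G, rfl⟩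
      exact Real.iSup_nonneg fun _ => abs_nonneg _
    · exact Real.iSup_le (fun y => by simpa using hpow y.1 y.2) zero_le_one
  have h1 := abs_le.mp ((le_ciSup hbdd ⟨x, hx⟩).trans hle)
  have h2 := abs_le.mp (hpow x hx)
  have h3 := Real.rpow_nonneg (abs_nonneg x) γ
  rw [abs_le]
  constructor <;> linarith [h1.1, h1.2, h2.1, h2.2]



/-- Lemma 4 (bound on coefficients of the best polynomial approximation of `|x|^γ`).
For every `γ > 0` there is a constant `C > 0` depending only on `γ` such that for every
integer `K ≥ 1` and every polynomial `P` of degree at most `2K` attaining the best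
uniform approximation of `|x|^γ` on `[−1,1]` among polynomials of degree at most `2K`,
all coefficients of `P` satisfy `|a_j| ≤ C · 6^K`. -/
theorem coeff_bound_best_approx_abs_rpow (γ : ℝ) (hγ : 0 < γ) :
    ∃ C : ℝ, 0 < C ∧
      ∀ K : ℕ, 1 ≤ K → ∀ P : Polynomial ℝ, P.natDegree ≤ 2 * K →
        ((⨆ x : Set.Icc (-1 : ℝ) 1, |(|x.1| ^ γ) - Polynomial.eval x.1 P|) =
          ⨅ G : {G : Polynomial ℝ // G.natDegree ≤ 2 * K},
            ⨆ x : Set.Icc (-1 : ℝ) 1, |(|x.1| ^ γ) - Polynomial.eval x.1 G.1|) →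
        ∀ j : ℕ, j ≤ 2 * K → |P.coeff j| ≤ C * 6 ^ K := by
  refine ⟨34 / 5, by norm_num, fun K _ P hP hbest j _ => ?_⟩
  have hcoeff := Chebyshev.abs_coeff_le_of_forall_abs_eval_le (r := 17 / 7) (by norm_num)
    (by norm_num) hP (abs_eval_le_two_of_best_approx_abs_rpow hγ hbest) j
  have hpow : ((17 / 7 : ℝ) ^ 2) ^ K ≤ 6 ^ K := pow_le_pow_left₀ (by norm_num) (by norm_num) K
  rw [geom_sum_eq (by norm_num), pow_succ, pow_mul] at hcoeff
  generalize ((17 / 7 : ℝ) ^ 2) ^ K = q at hcoeff hpow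
  rw [show (17 / 7 - 1 : ℝ) = 10 / 7 by norm_num] at hcoeff
  linarith
end

section
/- There exists an absolute constant C > 0 such that for every integer N ≥ 0 and every real polynomial P(x) = Σ_{k=0}^{N} a_k x^k satisfying |P(x)| ≤ 1 for all x ∈ [−1,1], one has |a_k| ≤ C (√2 + 1)^N for every k ∈ {0, 1, …, N}. -/
open Polynomial

namespace Polynomial.Chebyshev

open MeasureTheory Real

theorem abs_coeff_T_real_le (n k : ℕ) : |(T ℝ n).coeff k| ≤ (√2 + 1) ^ n := by
  induction n using Nat.twoStepInduction generalizing k with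
  | zero =>
    rw [Nat.cast_zero, T_zero, coeff_one]
    split_ifs <;> simp
  | one =>
    rw [Nat.cast_one, T_one, coeff_X]
    split_ifs <;> simp
    positivity
  | more n ih₀ ih₁ =>
    have hr : (√2 + 1) ^ (n + 2) = 2 * (√2 + 1) ^ (n + 1) + (√2 + 1) ^ n := by
      have hs : √2 ^ 2 = 2 := sq_sqrt (by norm_num)
      linear_combination (√2 + 1) ^ n * hs
    have hT : T ℝ (n + 2 : ℕ) = Polynomial.C 2 * (X * T ℝ (n + 1 : ℕ)) - T ℝ n := by
      push_cast
      rw [T_add_two, map_ofNat, mul_assoc]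
    rw [hT, coeff_sub, coeff_C_mul, hr]
    refine (abs_sub _ _).trans (add_le_add ?_ (ih₀ k))
    rw [abs_mul, abs_two]
    refine mul_le_mul_of_nonneg_left ?_ zero_le_two
    cases k with
    | zero => simp; positivity
    | succ k => rw [coeff_X_mul]; exact ih₁ k

theorem abs_integral_mul_T_real_le {P : ℝ[X]} (hP : ∀ x ∈ Set.Icc (-1 : ℝ) 1, |P.eval x| ≤ 1)
    (n : ℤ) : |∫ x, P.eval x * (T ℝ n).eval x ∂measureT| ≤ π := by
  rw [integral_measureT_eq_integral_cos, ← norm_eq_abs]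
  refine (intervalIntegral.norm_integral_le_of_norm_le_const (C := 1) fun θ _ ↦ ?_).trans ?_
  · rw [T_real_cos, norm_mul, norm_eq_abs, norm_eq_abs]
    exact mul_le_one₀ (hP _ ⟨neg_one_le_cos θ, cos_le_one θ⟩) (abs_nonneg _) (abs_cos_le_one _)
  · simp [abs_of_pos pi_pos]

theorem pi_div_two_le_integral_T_real_mul_self (n : ℕ) :
    π / 2 ≤ ∫ x, (T ℝ n).eval x * (T ℝ n).eval x ∂measureT := by
  rcases eq_or_ne n 0 with rfl | hn
  · rw [Nat.cast_zero, integral_eval_T_real_mul_self_measureT_zero]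
    linarith [pi_pos]
  · rw [integral_T_real_mul_self_measureT_of_ne_zero hn]

theorem integral_sum_smul_T_real_mul_T_real {s : Finset ℕ} (c : ℕ → ℝ) {n : ℕ} (hn : n ∈ s) :
    ∫ x, (∑ i ∈ s, c i • T ℝ i).eval x * (T ℝ n).eval x ∂measureT =
      c n * ∫ x, (T ℝ n).eval x * (T ℝ n).eval x ∂measureT := by
  simp_rw [eval_finsetSum, eval_smul, smul_eq_mul, Finset.sum_mul, mul_assoc]
  rw [integral_finsetSum _ fun i _ ↦ integrable_measureT (by fun_prop)]
  simp_rw [integral_const_mul]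
  refine Finset.sum_eq_single_of_mem n hn fun i _ hi ↦ ?_
  rw [integral_eval_T_real_mul_eval_T_real_measureT_of_ne hi, mul_zero]

theorem abs_le_two_of_abs_eval_sum_smul_T_real_le_one {s : Finset ℕ} {c : ℕ → ℝ}
    (hP : ∀ x ∈ Set.Icc (-1 : ℝ) 1, |(∑ i ∈ s, c i • T ℝ i).eval x| ≤ 1) {n : ℕ} (hn : n ∈ s) :
    |c n| ≤ 2 := by
  have h₁ := abs_integral_mul_T_real_le hP n
  have h₂ := pi_div_two_le_integral_T_real_mul_self n
  rw [integral_sum_smul_T_real_mul_T_real c hn, abs_mul,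
    abs_of_nonneg ((half_pos pi_pos).le.trans h₂)] at h₁
  have h₃ := (mul_le_mul_of_nonneg_left h₂ (abs_nonneg (c n))).trans h₁
  refine le_of_mul_le_mul_right ?_ (half_pos pi_pos)
  linarith

theorem exists_eq_sum_smul_T_real {P : ℝ[X]} {N : ℕ} (hP : P.natDegree ≤ N) :
    ∃ c : ℕ → ℝ, P = ∑ i ∈ Finset.range (N + 1), c i • T ℝ i := by
  have hmem : P ∈ degreeLT ℝ (N + 1) :=
    mem_degreeLT.2 <| (degree_le_of_natDegree_le hP).trans_lt <| by exact_mod_cast N.lt_succ_self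
  rw [← Sequence.span_degreeLT (chebyshevTsequence ℝ)
      (fun i _ ↦ (leadingCoeff_ne_zero.2 ((chebyshevTsequence ℝ).ne_zero i)).isUnit),
    show Set.Iio (N + 1) = Finset.range (N + 1) by simp,
    Submodule.mem_span_image_finset_iff_exists_fun'] at hmem
  obtain ⟨c, rfl⟩ := hmem
  exact ⟨c, rfl⟩

end Polynomial.Chebyshev

theorem sum_range_succ_pow_le_two_mul_pow {r : ℝ} (hr : 2 ≤ r) (N : ℕ) :
    ∑ i ∈ Finset.range (N + 1), r ^ i ≤ 2 * r ^ N := by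
  induction N with
  | zero => simp
  | succ N ih =>
    rw [Finset.sum_range_succ]
    have : 2 * r ^ N ≤ r ^ (N + 1) := by
      rw [pow_succ']
      gcongr
    linarith

/-- Proposition 2 (Szegő-type coefficient bound). There exists an absolute constant
`C > 0` such that for every integer `N ≥ 0` and every real polynomial
`P(x) = Σ_{k=0}^N a_k x^k` with `|P(x)| ≤ 1` on `[−1,1]`, one has
`|a_k| ≤ C (√2 + 1)^N` for every `k ∈ {0, …, N}`. -/
theorem coeff_bound_of_bounded_on_Icc :
    ∃ C : ℝ, 0 < C ∧
      ∀ N : ℕ, ∀ P : Polynomial ℝ, P.natDegree ≤ N →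
        (∀ x ∈ Set.Icc (-1 : ℝ) 1, |Polynomial.eval x P| ≤ 1) →
        ∀ k : ℕ, k ≤ N → |P.coeff k| ≤ C * (Real.sqrt 2 + 1) ^ N := by
  refine ⟨4, by norm_num, fun N P hN hP k _ ↦ ?_⟩
  obtain ⟨c, rfl⟩ := Chebyshev.exists_eq_sum_smul_T_real hN
  have hr : 2 ≤ Real.sqrt 2 + 1 := by
    linarith [Real.one_le_sqrt.2 (one_le_two (α := ℝ))]
  calc |(∑ i ∈ Finset.range (N + 1), c i • Chebyshev.T ℝ i).coeff k|
      ≤ ∑ i ∈ Finset.range (N + 1), |c i * (Chebyshev.T ℝ i).coeff k| := by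
        simp_rw [finsetSum_coeff, coeff_smul, smul_eq_mul]
        exact Finset.abs_sum_le_sum_abs _ _
    _ ≤ ∑ i ∈ Finset.range (N + 1), 2 * (Real.sqrt 2 + 1) ^ i := by
        refine Finset.sum_le_sum fun i hi ↦ ?_
        rw [abs_mul]
        exact mul_le_mul (Chebyshev.abs_le_two_of_abs_eval_sum_smul_T_real_le_one hP hi)
          (Chebyshev.abs_coeff_T_real_le i k) (abs_nonneg _) zero_le_two
    _ ≤ 4 * (Real.sqrt 2 + 1) ^ N := by
        rw [← Finset.mul_sum]
        linarith [sum_range_succ_pow_le_two_mul_pow hr N]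
end

section
/- Let ε > 0, M > 0, and let K ≥ 1 be an integer. Let μ̃₀ and μ̃₁ be Borel probability measures supported on [−M, M] such that ∫ t^l dμ̃₀(t) = ∫ t^l dμ̃₁(t) for all l = 0, 1, …, K. Let φ be the density of N(0, ε²) and define φ_i(x) = ∫ φ(x − t) dμ̃_i(t) for i = 0, 1. Then, with Λ = M/ε, ∫_ℝ (φ₀(x) − φ₁(x))² / φ(x) dx ≤ Σ_{k=K+1}^{∞} Λ^{2k} / k!. -/
open MeasureTheory ProbabilityTheory Real

/-- The product of two translates of a centered Gaussian density, divided by the density, is an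
exponentially weighted translate of the density. -/
lemma gaussianPDFReal_sub_mul_sub_div {v : NNReal} (hv : v ≠ 0) (x s t : ℝ) :
    gaussianPDFReal 0 v (x - s) * gaussianPDFReal 0 v (x - t) / gaussianPDFReal 0 v x
      = exp (s * t / v) * gaussianPDFReal (s + t) v x := by
  have hv' : (v : ℝ) ≠ 0 := by exact_mod_cast hv
  have h2 : √(2 * π * v) ≠ 0 := by positivity
  rw [div_eq_iff (gaussianPDFReal_pos 0 v x hv).ne']
  simp only [gaussianPDFReal]
  have h : rexp (-(x - s - 0) ^ 2 / (2 * v)) * rexp (-(x - t - 0) ^ 2 / (2 * v))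
      = rexp (s * t / v) * rexp (-(x - (s + t)) ^ 2 / (2 * v)) * rexp (-(x - 0) ^ 2 / (2 * v)) := by
    rw [← exp_add, ← exp_add, ← exp_add]
    congr 1
    field_simp
    ring
  linear_combination ((√(2 * π * v))⁻¹) ^ 2 * h

lemma ae_abs_le_of_compl_Icc {M : ℝ} {μ : Measure ℝ} (h : μ (Set.Icc (-M) M)ᶜ = 0) :
    ∀ᵐ t ∂μ, |t| ≤ M := by
  have h' : ∀ᵐ t ∂μ, t ∈ Set.Icc (-M) M := h
  filter_upwards [h'] with t ht using abs_le.2 ht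

lemma integrable_of_continuous_of_ae_abs_le {M : ℝ} {μ : Measure ℝ} [IsFiniteMeasure μ]
    (h : ∀ᵐ t ∂μ, |t| ≤ M) {f : ℝ → ℝ} (hf : Continuous f) : Integrable f μ := by
  obtain ⟨C, hC⟩ := (isCompact_Icc (a := -M) (b := M)).exists_bound_of_continuousOn hf.continuousOn
  refine Integrable.of_bound hf.aestronglyMeasurable C ?_
  filter_upwards [h] with t ht using hC t (abs_le.1 ht)

lemma ae_prod_abs_le {M : ℝ} {μ ν : Measure ℝ} [IsProbabilityMeasure μ] [IsProbabilityMeasure ν]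
    (hμ : ∀ᵐ t ∂μ, |t| ≤ M) (hν : ∀ᵐ t ∂ν, |t| ≤ M) :
    ∀ᵐ p ∂μ.prod ν, |p.1| ≤ M ∧ |p.2| ≤ M :=
  (Measure.quasiMeasurePreserving_fst.ae hμ).and (Measure.quasiMeasurePreserving_snd.ae hν)

/-- The exponential kernel integrates to the exponential series in the moments. -/
lemma hasSum_integral_exp_mul {M v : ℝ} (hv : 0 < v) {μ ν : Measure ℝ}
    [IsProbabilityMeasure μ] [IsProbabilityMeasure ν]
    (hμ : ∀ᵐ t ∂μ, |t| ≤ M) (hν : ∀ᵐ t ∂ν, |t| ≤ M) :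
    HasSum (fun k : ℕ => (∫ t, t ^ k ∂μ) * (∫ t, t ^ k ∂ν) / (v ^ k * k.factorial))
      (∫ p : ℝ × ℝ, exp (p.1 * p.2 / v) ∂μ.prod ν) := by
  have key := hasSum_integral_of_dominated_convergence (μ := μ.prod ν)
    (F := fun (k : ℕ) (p : ℝ × ℝ) => (p.1 * p.2 / v) ^ k / k.factorial)
    (f := fun p : ℝ × ℝ => exp (p.1 * p.2 / v))
    (fun (k : ℕ) (_ : ℝ × ℝ) => (M * M / v) ^ k / k.factorial)
    (fun k => by fun_prop) ?_ (Filter.Eventually.of_forall fun _ => summable_pow_div_factorial _)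
    (integrable_const _) (Filter.Eventually.of_forall fun p => ?_)
  · have hcoef : (fun k : ℕ => (∫ t, t ^ k ∂μ) * (∫ t, t ^ k ∂ν) / (v ^ k * k.factorial))
        = fun k : ℕ => ∫ p : ℝ × ℝ, (p.1 * p.2 / v) ^ k / k.factorial ∂μ.prod ν := by
      ext k
      rw [← integral_prod_mul (μ := μ) (ν := ν) (fun t => t ^ k) (fun t => t ^ k), ← integral_div]
      congr 1 with p
      rw [div_pow, mul_pow, div_div]
    rw [hcoef]
    exact key
  · intro k
    filter_upwards [ae_prod_abs_le hμ hν] with p hp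
    rw [norm_div, norm_pow, norm_div, norm_mul, Real.norm_of_nonneg hv.le]
    simp only [Real.norm_eq_abs, Nat.abs_cast]
    have : 0 ≤ M := (abs_nonneg _).trans hp.1
    gcongr
    exacts [hp.1, hp.2]
  · rw [Real.exp_eq_exp_ℝ]
    exact NormedSpace.expSeries_div_hasSum_exp _

lemma integrable_exp_mul_prod {M v : ℝ} (hv : 0 < v) {μ ν : Measure ℝ}
    [IsProbabilityMeasure μ] [IsProbabilityMeasure ν]
    (hμ : ∀ᵐ t ∂μ, |t| ≤ M) (hν : ∀ᵐ t ∂ν, |t| ≤ M) :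
    Integrable (fun p : ℝ × ℝ => exp (p.1 * p.2 / v)) (μ.prod ν) := by
  refine Integrable.of_bound (by fun_prop) (exp (M * M / v)) ?_
  filter_upwards [ae_prod_abs_le hμ hν] with p hp
  rw [Real.norm_of_nonneg (exp_pos _).le]
  have : 0 ≤ M := (abs_nonneg _).trans hp.1
  refine exp_le_exp.2 (div_le_div_of_nonneg_right ?_ hv.le)
  calc p.1 * p.2 ≤ |p.1| * |p.2| := (le_abs_self _).trans (abs_mul _ _).le
    _ ≤ M * M := by gcongr; exacts [hp.1, hp.2]

/-- The chi-square cross term of two Gaussian mixtures. -/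
lemma integrable_and_integral_mixture_mul_div {M : ℝ} {v : NNReal} (hv : v ≠ 0) {μ ν : Measure ℝ}
    [IsProbabilityMeasure μ] [IsProbabilityMeasure ν]
    (hμ : ∀ᵐ t ∂μ, |t| ≤ M) (hν : ∀ᵐ t ∂ν, |t| ≤ M) :
    Integrable (fun x => (∫ t, gaussianPDFReal 0 v (x - t) ∂μ) *
        (∫ t, gaussianPDFReal 0 v (x - t) ∂ν) / gaussianPDFReal 0 v x) ∧
      ∫ x, (∫ t, gaussianPDFReal 0 v (x - t) ∂μ) *
        (∫ t, gaussianPDFReal 0 v (x - t) ∂ν) / gaussianPDFReal 0 v x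
        = ∫ p : ℝ × ℝ, exp (p.1 * p.2 / v) ∂μ.prod ν := by
  have hv' : (0 : ℝ) < v := by positivity
  have hF : Integrable (fun q : ℝ × (ℝ × ℝ) =>
      exp (q.2.1 * q.2.2 / v) * gaussianPDFReal (q.2.1 + q.2.2) v q.1)
      ((volume : Measure ℝ).prod (μ.prod ν)) := by
    refine (integrable_prod_iff' ?_).2 ⟨Filter.Eventually.of_forall fun p => ?_, ?_⟩
    · simp only [gaussianPDFReal]
      exact Measurable.aestronglyMeasurable (by fun_prop)
    · exact (integrable_gaussianPDFReal (p.1 + p.2) v).const_mul (exp (p.1 * p.2 / v))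
    · refine (integrable_exp_mul_prod hv' hμ hν).congr (Filter.Eventually.of_forall fun p => ?_)
      simp [abs_of_nonneg (gaussianPDFReal_nonneg _ _ _), integral_const_mul,
        integral_gaussianPDFReal_eq_one _ hv]
  have hmix : (fun x => (∫ t, gaussianPDFReal 0 v (x - t) ∂μ) *
        (∫ t, gaussianPDFReal 0 v (x - t) ∂ν) / gaussianPDFReal 0 v x) = fun x =>
      ∫ p : ℝ × ℝ, exp (p.1 * p.2 / v) * gaussianPDFReal (p.1 + p.2) v x ∂μ.prod ν := by
    ext x
    rw [← integral_prod_mul (μ := μ) (ν := ν) (fun t => gaussianPDFReal 0 v (x - t))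
      (fun t => gaussianPDFReal 0 v (x - t)), ← integral_div]
    simp only [gaussianPDFReal_sub_mul_sub_div hv]
  rw [hmix]
  refine ⟨hF.integral_prod_left, ?_⟩
  rw [integral_integral_swap hF]
  simp [integral_const_mul, integral_gaussianPDFReal_eq_one _ hv]

/-- A function uniformly within `C / 2` of one with matching integrals has integrals within `C`. -/
lemma abs_integral_sub_integral_le_of_approx {M C : ℝ} {μ ν : Measure ℝ}
    [IsProbabilityMeasure μ] [IsProbabilityMeasure ν]
    (hμ : ∀ᵐ t ∂μ, |t| ≤ M) (hν : ∀ᵐ t ∂ν, |t| ≤ M) {f g : ℝ → ℝ} (hf : Continuous f)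
    (hg : Continuous g) (hgi : ∫ t, g t ∂μ = ∫ t, g t ∂ν)
    (hfg : ∀ t, |t| ≤ M → |f t - g t| ≤ C / 2) :
    |∫ t, f t ∂μ - ∫ t, f t ∂ν| ≤ C := by
  have key : ∀ ρ : Measure ℝ, IsProbabilityMeasure ρ → (∀ᵐ t ∂ρ, |t| ≤ M) →
      |∫ t, f t ∂ρ - ∫ t, g t ∂ρ| ≤ C / 2 := by
    intro ρ _ hρ
    rw [← integral_sub (integrable_of_continuous_of_ae_abs_le hρ hf)
      (integrable_of_continuous_of_ae_abs_le hρ hg), ← Real.norm_eq_abs]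
    simpa using norm_integral_le_of_norm_le_const (μ := ρ) (C := C / 2)
      (f := fun t => f t - g t) (hρ.mono fun t ht => hfg t ht)
  have h1 := abs_le.1 (key μ inferInstance hμ)
  have h2 := abs_le.1 (key ν inferInstance hν)
  rw [abs_le]
  constructor <;> linarith [h1.1, h1.2, h2.1, h2.2]

/-- Two laws on `[-M, M]` with equal means have `k`-th moments differing by at most `M ^ k`. -/
lemma abs_moment_sub_le {M : ℝ} (hM : 0 < M) {μ ν : Measure ℝ}
    [IsProbabilityMeasure μ] [IsProbabilityMeasure ν]
    (hμ : ∀ᵐ t ∂μ, |t| ≤ M) (hν : ∀ᵐ t ∂ν, |t| ≤ M) (hmean : ∫ t, t ∂μ = ∫ t, t ∂ν) (k : ℕ) :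
    |∫ t, t ^ k ∂μ - ∫ t, t ^ k ∂ν| ≤ M ^ k := by
  rcases Nat.even_or_odd k with hk | ⟨m, rfl⟩
  · refine abs_integral_sub_integral_le_of_approx hμ hν (g := fun _ => M ^ k / 2)
      (by fun_prop) (by fun_prop) (by simp [integral_const]) fun t ht => ?_
    have h1 : 0 ≤ t ^ k := hk.pow_nonneg t
    have h2 : t ^ k ≤ M ^ k := by
      rw [← hk.pow_abs]
      gcongr
    rw [abs_le]
    constructor <;> linarith
  · refine abs_integral_sub_integral_le_of_approx hμ hν (g := fun t => M ^ (2 * m) / 2 * t)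
      (by fun_prop) (by fun_prop) ?_ fun t ht => ?_
    · rw [integral_const_mul, integral_const_mul, hmean]
    have he : Even (2 * m) := even_two_mul m
    have h1 : 0 ≤ t ^ (2 * m) := he.pow_nonneg t
    have h2 : t ^ (2 * m) ≤ M ^ (2 * m) := by
      rw [← he.pow_abs]
      gcongr
    have h3 : |t ^ (2 * m) - M ^ (2 * m) / 2| ≤ M ^ (2 * m) / 2 := by
      rw [abs_le]
      constructor <;> linarith
    calc |t ^ (2 * m + 1) - M ^ (2 * m) / 2 * t|
        = |t ^ (2 * m) - M ^ (2 * m) / 2| * |t| := by rw [← abs_mul]; ring_nf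
      _ ≤ M ^ (2 * m) / 2 * M := by gcongr
      _ = M ^ (2 * m + 1) / 2 := by ring

/-- The chi-square distance between Gaussian mixtures as a series in the moment differences. -/
lemma hasSum_integral_mixture_sub_sq_div {M : ℝ} {v : NNReal} (hv : v ≠ 0) {μ ν : Measure ℝ}
    [IsProbabilityMeasure μ] [IsProbabilityMeasure ν]
    (hμ : ∀ᵐ t ∂μ, |t| ≤ M) (hν : ∀ᵐ t ∂ν, |t| ≤ M) :
    HasSum (fun k : ℕ => (∫ t, t ^ k ∂μ - ∫ t, t ^ k ∂ν) ^ 2 / ((v : ℝ) ^ k * k.factorial))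
      (∫ x, ((∫ t, gaussianPDFReal 0 v (x - t) ∂μ) - (∫ t, gaussianPDFReal 0 v (x - t) ∂ν)) ^ 2 /
          gaussianPDFReal 0 v x) := by
  have hv' : (0 : ℝ) < v := by positivity
  obtain ⟨i1, e1⟩ := integrable_and_integral_mixture_mul_div hv hμ hμ
  obtain ⟨i2, e2⟩ := integrable_and_integral_mixture_mul_div hv hμ hν
  obtain ⟨i3, e3⟩ := integrable_and_integral_mixture_mul_div hv hν hν
  have hval : ∫ x, ((∫ t, gaussianPDFReal 0 v (x - t) ∂μ) -
        (∫ t, gaussianPDFReal 0 v (x - t) ∂ν)) ^ 2 / gaussianPDFReal 0 v x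
      = ∫ p : ℝ × ℝ, exp (p.1 * p.2 / v) ∂μ.prod μ
        - 2 * ∫ p : ℝ × ℝ, exp (p.1 * p.2 / v) ∂μ.prod ν
        + ∫ p : ℝ × ℝ, exp (p.1 * p.2 / v) ∂ν.prod ν := by
    rw [← e1, ← e2, ← e3, ← integral_const_mul, ← integral_sub i1 (i2.const_mul 2)]
    refine Eq.trans ?_ (integral_add (i1.sub (i2.const_mul 2)) i3)
    congr 1 with x
    ring
  have hsum := ((hasSum_integral_exp_mul hv' hμ hμ).sub
    ((hasSum_integral_exp_mul hv' hμ hν).mul_left 2)).add (hasSum_integral_exp_mul hv' hν hν)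
  rw [← hval] at hsum
  refine hsum.congr_fun fun k => ?_
  ring

/-- Lemma 6 (chi-square-type bound from moment matching). Let `ε, M > 0`, `K ≥ 1`, and
let `μ̃₀, μ̃₁` be Borel probability measures supported on `[−M, M]` whose moments of
orders `0, 1, …, K` coincide. With `φ` the density of `N(0, ε²)` and
`φ_i(x) = ∫ φ(x − t) dμ̃_i(t)`, one has, for `Λ = M/ε`,
`∫ (φ₀ − φ₁)²/φ ≤ Σ_{k=K+1}^∞ Λ^{2k}/k!`. -/
theorem chi_square_moment_matching (ε M : ℝ) (hε : 0 < ε) (hM : 0 < M) (K : ℕ)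
    (hK : 1 ≤ K) (μ0 μ1 : Measure ℝ) (h0 : IsProbabilityMeasure μ0)
    (h1 : IsProbabilityMeasure μ1)
    (hs0 : μ0 (Set.Icc (-M) M)ᶜ = 0) (hs1 : μ1 (Set.Icc (-M) M)ᶜ = 0)
    (hmom : ∀ l : ℕ, l ≤ K → ∫ t, t ^ l ∂μ0 = ∫ t, t ^ l ∂μ1) :
    ∫ x, ((∫ t, gaussianPDFReal 0 (ε ^ 2).toNNReal (x - t) ∂μ0) -
            (∫ t, gaussianPDFReal 0 (ε ^ 2).toNNReal (x - t) ∂μ1)) ^ 2 /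
          gaussianPDFReal 0 (ε ^ 2).toNNReal x
      ≤ ∑' k : ℕ, (M / ε) ^ (2 * (k + K + 1)) / (Nat.factorial (k + K + 1)) := by
  have hμ := ae_abs_le_of_compl_Icc hs0
  have hν := ae_abs_le_of_compl_Icc hs1
  have hv : (ε ^ 2).toNNReal ≠ 0 := (Real.toNNReal_pos.2 (by positivity)).ne'
  have hsum := hasSum_integral_mixture_sub_sq_div hv hμ hν
  rw [← hsum.tsum_eq, ← hsum.summable.sum_add_tsum_nat_add (K + 1), Finset.sum_eq_zero, zero_add]
  · refine Summable.tsum_le_tsum (fun k => ?_) ((summable_nat_add_iff (K + 1)).2 hsum.summable) ?_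
    · have hmean : ∫ t, t ∂μ0 = ∫ t, t ∂μ1 := by simpa using hmom 1 hK
      have h := abs_moment_sub_le hM hμ hν hmean (k + (K + 1))
      rw [Real.coe_toNNReal _ (by positivity), ← add_assoc] at *
      rw [← div_div, pow_mul, div_pow M, div_pow, ← pow_mul M, mul_comm 2, pow_mul M, ← sq_abs]
      gcongr
    · simpa only [pow_mul, add_assoc] using (summable_nat_add_iff (K + 1)).2
        (summable_pow_div_factorial ((M / ε) ^ 2))
  · intro k hk
    rw [hmom k (Nat.lt_succ_iff.1 (Finset.mem_range.1 hk))]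
    simp
end

section
/- Let d, s be integers with 1 ≤ s ≤ d and s² ≥ 4d, and let ε > 0. Set Λ = √(log(s²/d)), M = ε Λ, and let K be the smallest even integer with K ≥ (3/2) e log(s²/d). Let μ̃₀ and μ̃₁ be Borel probability measures supported on [−M, M] whose moments of orders 0, 1, …, K coincide. Let φ be the density of N(0, ε²), φ_i(x) = ∫ φ(x − t) dμ̃_i(t) for i = 0, 1, and define the densities h = (s/(2d)) φ₀ + (1 − s/(2d)) φ and g = (s/(2d)) φ₁ + (1 − s/(2d)) φ. Then the chi-square divergence between the corresponding d-fold product measures satisfies χ²(ℙ₁, ℙ₀) = (1 + ∫_ℝ (g(x) − h(x))² / h(x) dx)^d − 1 < 1/4. -/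
open MeasureTheory ProbabilityTheory Real

open scoped NNReal

theorem gaussianPDFReal_shift_mul_shift_div {v : ℝ≥0} (hv : v ≠ 0) (x t u : ℝ) :
    gaussianPDFReal 0 v (x - t) * gaussianPDFReal 0 v (x - u) / gaussianPDFReal 0 v x
      = gaussianPDFReal 0 v (x - (t + u)) * exp (t * u / v) := by
  have hv' : (v : ℝ) ≠ 0 := by exact_mod_cast hv
  rw [div_eq_iff (gaussianPDFReal_pos 0 v x hv).ne']
  simp only [gaussianPDFReal, sub_zero]
  have : exp (-(x - t) ^ 2 / (2 * v)) * exp (-(x - u) ^ 2 / (2 * v))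
      = exp (-(x - (t + u)) ^ 2 / (2 * v)) * exp (t * u / v) * exp (-x ^ 2 / (2 * v)) := by
    rw [← exp_add, ← exp_add, ← exp_add]
    congr 1
    field_simp
    ring
  linear_combination (√(2 * π * v))⁻¹ ^ 2 * this

theorem integral_sub_const_mul_add {α : Type*} [MeasurableSpace α] {μ : Measure α} {f g h : α → ℝ}
    (hf : Integrable f μ) (hg : Integrable g μ) (hh : Integrable h μ) (c : ℝ) :
    ∫ x, (f x - c * g x + h x) ∂μ = ∫ x, f x ∂μ - c * ∫ x, g x ∂μ + ∫ x, h x ∂μ := by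
  rw [← integral_const_mul, ← integral_sub hf (hg.const_mul c)]
  exact integral_add (hf.sub (hg.const_mul c)) hh

theorem ae_abs_le_of_measure_Icc_compl {μ : Measure ℝ} {M : ℝ}
    (hμ : μ (Set.Icc (-M) M)ᶜ = 0) : ∀ᵐ t ∂μ, |t| ≤ M := by
  filter_upwards [mem_ae_iff.2 hμ] with t ht using abs_le.2 ht

theorem ae_prod_abs_mul_le {μ ν : Measure ℝ} [IsProbabilityMeasure μ] [IsProbabilityMeasure ν]
    {M : ℝ} (hμ : ∀ᵐ t ∂μ, |t| ≤ M) (hν : ∀ᵐ t ∂ν, |t| ≤ M) :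
    ∀ᵐ p ∂μ.prod ν, |p.1 * p.2| ≤ M ^ 2 := by
  filter_upwards [Measure.quasiMeasurePreserving_fst.ae hμ,
    Measure.quasiMeasurePreserving_snd.ae hν] with p h1 h2
  rw [abs_mul, sq]
  exact mul_le_mul h1 h2 (abs_nonneg _) ((abs_nonneg _).trans h1)

theorem integrable_exp_mul_div_prod {μ ν : Measure ℝ} [IsProbabilityMeasure μ]
    [IsProbabilityMeasure ν] {M : ℝ} (hμ : ∀ᵐ t ∂μ, |t| ≤ M) (hν : ∀ᵐ t ∂ν, |t| ≤ M) (v : ℝ≥0) :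
    Integrable (fun p : ℝ × ℝ => exp (p.1 * p.2 / v)) (μ.prod ν) := by
  refine Integrable.of_bound (by fun_prop) (exp (M ^ 2 / v)) ?_
  filter_upwards [ae_prod_abs_mul_le hμ hν] with p hp
  rw [norm_of_nonneg (exp_pos _).le]
  gcongr
  exact (le_abs_self _).trans hp

/-- The `L²(1/φ)` inner product of two Gaussian convolutions. -/
theorem integral_gaussian_conv_mul_conv_div {v : ℝ≥0} (hv : v ≠ 0) {μ ν : Measure ℝ}
    [IsProbabilityMeasure μ] [IsProbabilityMeasure ν] {M : ℝ}
    (hμ : ∀ᵐ t ∂μ, |t| ≤ M) (hν : ∀ᵐ t ∂ν, |t| ≤ M) :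
    Integrable (fun x => (∫ t, gaussianPDFReal 0 v (x - t) ∂μ) *
        (∫ t, gaussianPDFReal 0 v (x - t) ∂ν) / gaussianPDFReal 0 v x) ∧
      ∫ x, (∫ t, gaussianPDFReal 0 v (x - t) ∂μ) *
        (∫ t, gaussianPDFReal 0 v (x - t) ∂ν) / gaussianPDFReal 0 v x
        = ∫ p, exp (p.1 * p.2 / v) ∂(μ.prod ν) := by
  set F : ℝ → ℝ × ℝ → ℝ := fun x p =>
    gaussianPDFReal 0 v (x - (p.1 + p.2)) * exp (p.1 * p.2 / v) with hF
  have hx (p : ℝ × ℝ) : ∫ x, F x p = exp (p.1 * p.2 / v) := by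
    simp only [hF]
    rw [integral_mul_const, integral_sub_right_eq_self (gaussianPDFReal 0 v) (p.1 + p.2),
      integral_gaussianPDFReal_eq_one 0 hv, one_mul]
  have hFnn (x : ℝ) (p : ℝ × ℝ) : 0 ≤ F x p :=
    mul_nonneg (gaussianPDFReal_nonneg _ _ _) (exp_pos _).le
  have hmeas : Measurable (Function.uncurry F) := by
    have := measurable_gaussianPDFReal 0 v
    simp only [hF, Function.uncurry_def]
    fun_prop
  have hint : Integrable (Function.uncurry F) (volume.prod (μ.prod ν)) := by
    rw [integrable_prod_iff' hmeas.aestronglyMeasurable]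
    refine ⟨.of_forall fun p => ?_, ?_⟩
    · exact ((integrable_gaussianPDFReal 0 v).comp_sub_right (p.1 + p.2)).mul_const
        (exp (p.1 * p.2 / v))
    · refine (integrable_exp_mul_div_prod hμ hν v).congr (.of_forall fun p => ?_)
      simp only [Function.uncurry_apply_pair, norm_of_nonneg (hFnn _ _), hx]
  have hconv (x : ℝ) : (∫ t, gaussianPDFReal 0 v (x - t) ∂μ) *
        (∫ t, gaussianPDFReal 0 v (x - t) ∂ν) / gaussianPDFReal 0 v x
        = ∫ p, F x p ∂(μ.prod ν) := by
    rw [← integral_prod_mul, ← integral_div]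
    simp only [hF, gaussianPDFReal_shift_mul_shift_div hv]
  simp only [hconv]
  refine ⟨hint.integral_prod_left, ?_⟩
  rw [integral_integral_swap hint]
  simp only [hx]

theorem hasSum_moments_integral_exp_mul {v : ℝ≥0} {μ ν : Measure ℝ}
    [IsProbabilityMeasure μ] [IsProbabilityMeasure ν] {M : ℝ}
    (hμ : ∀ᵐ t ∂μ, |t| ≤ M) (hν : ∀ᵐ t ∂ν, |t| ≤ M) :
    HasSum (fun k : ℕ => (∫ t, t ^ k ∂μ) * (∫ t, t ^ k ∂ν) / ((v : ℝ) ^ k * k.factorial))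
      (∫ p, exp (p.1 * p.2 / v) ∂(μ.prod ν)) := by
  have hterm (k : ℕ) : (∫ t, t ^ k ∂μ) * (∫ t, t ^ k ∂ν) / ((v : ℝ) ^ k * k.factorial)
      = ∫ p, (p.1 * p.2 / v) ^ k / k.factorial ∂(μ.prod ν) := by
    rw [← integral_prod_mul, ← integral_div]
    congr 1 with p
    rw [div_pow, mul_pow, div_div]
  simp only [hterm]
  refine hasSum_integral_of_dominated_convergence
    (fun k _ => (M ^ 2 / v) ^ k / k.factorial) (fun k => by fun_prop) (fun k => ?_) ?_ ?_ ?_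
  · filter_upwards [ae_prod_abs_mul_le hμ hν] with p hp
    rw [norm_div, norm_pow, norm_div, Real.norm_eq_abs, NNReal.norm_eq, Real.norm_natCast]
    gcongr
  · exact .of_forall fun _ => Real.summable_pow_div_factorial _
  · exact integrable_const _
  · refine .of_forall fun p => ?_
    rw [Real.exp_eq_exp_ℝ]
    exact NormedSpace.expSeries_div_hasSum_exp _

theorem sq_sub_moment_le {μ ν : Measure ℝ} [IsProbabilityMeasure μ] [IsProbabilityMeasure ν]
    {M : ℝ} (hμ : ∀ᵐ t ∂μ, |t| ≤ M) (hν : ∀ᵐ t ∂ν, |t| ≤ M) (k : ℕ) :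
    (∫ t, t ^ k ∂μ - ∫ t, t ^ k ∂ν) ^ 2 ≤ 4 * (M ^ 2) ^ k := by
  have key (ρ : Measure ℝ) [IsProbabilityMeasure ρ] (hρ : ∀ᵐ t ∂ρ, |t| ≤ M) :
      |∫ t, t ^ k ∂ρ| ≤ M ^ k := by
    have := norm_integral_le_of_norm_le_const (f := fun t : ℝ => t ^ k) (C := M ^ k) (μ := ρ)
      (by filter_upwards [hρ] with t ht
          rw [norm_pow, Real.norm_eq_abs]
          gcongr)
    simpa using this
  have h : |∫ t, t ^ k ∂μ - ∫ t, t ^ k ∂ν| ≤ 2 * M ^ k := by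
    linarith [abs_sub (∫ t, t ^ k ∂μ) (∫ t, t ^ k ∂ν), key μ hμ, key ν hν]
  calc _ = |∫ t, t ^ k ∂μ - ∫ t, t ^ k ∂ν| ^ 2 := (sq_abs _).symm
    _ ≤ (2 * M ^ k) ^ 2 := by gcongr
    _ = _ := by ring

/-- Moment matching makes two Gaussian convolutions close in `L²(1/φ)`. -/
theorem integral_sq_sub_gaussian_conv_div_le {v : ℝ≥0} (hv : v ≠ 0) {μ ν : Measure ℝ}
    [IsProbabilityMeasure μ] [IsProbabilityMeasure ν] {M : ℝ}
    (hμ : ∀ᵐ t ∂μ, |t| ≤ M) (hν : ∀ᵐ t ∂ν, |t| ≤ M) {K : ℕ}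
    (hmom : ∀ l ≤ K, ∫ t, t ^ l ∂μ = ∫ t, t ^ l ∂ν) :
    Integrable (fun x => ((∫ t, gaussianPDFReal 0 v (x - t) ∂μ) -
        ∫ t, gaussianPDFReal 0 v (x - t) ∂ν) ^ 2 / gaussianPDFReal 0 v x) ∧
      ∫ x, ((∫ t, gaussianPDFReal 0 v (x - t) ∂μ) -
        ∫ t, gaussianPDFReal 0 v (x - t) ∂ν) ^ 2 / gaussianPDFReal 0 v x
        ≤ exp (4 * (M ^ 2 / v)) / 4 ^ K := by
  obtain ⟨i1, e1⟩ := integral_gaussian_conv_mul_conv_div hv hμ hμ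
  obtain ⟨i2, e2⟩ := integral_gaussian_conv_mul_conv_div hv hμ hν
  obtain ⟨i3, e3⟩ := integral_gaussian_conv_mul_conv_div hv hν hν
  have hexp (x : ℝ) : ((∫ t, gaussianPDFReal 0 v (x - t) ∂μ) -
        ∫ t, gaussianPDFReal 0 v (x - t) ∂ν) ^ 2 / gaussianPDFReal 0 v x =
      (∫ t, gaussianPDFReal 0 v (x - t) ∂μ) * (∫ t, gaussianPDFReal 0 v (x - t) ∂μ) /
          gaussianPDFReal 0 v x
        - 2 * ((∫ t, gaussianPDFReal 0 v (x - t) ∂μ) * (∫ t, gaussianPDFReal 0 v (x - t) ∂ν) /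
          gaussianPDFReal 0 v x)
        + (∫ t, gaussianPDFReal 0 v (x - t) ∂ν) * (∫ t, gaussianPDFReal 0 v (x - t) ∂ν) /
          gaussianPDFReal 0 v x := by ring
  simp only [hexp]
  refine ⟨(i1.sub (i2.const_mul 2)).add i3, ?_⟩
  rw [integral_sub_const_mul_add i1 i2 i3, e1, e2, e3]
  have hsum := ((hasSum_moments_integral_exp_mul (v := v) hμ hμ).sub
    ((hasSum_moments_integral_exp_mul (v := v) hμ hν).mul_left 2)).add
    (hasSum_moments_integral_exp_mul (v := v) hν hν)
  have hbd : HasSum (fun k : ℕ => (4 * (M ^ 2 / v)) ^ k / k.factorial / 4 ^ K)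
      (exp (4 * (M ^ 2 / v)) / 4 ^ K) := by
    rw [Real.exp_eq_exp_ℝ]
    exact (NormedSpace.expSeries_div_hasSum_exp _).div_const _
  refine hasSum_le (fun k => ?_) hsum hbd
  calc _ = (∫ t, t ^ k ∂μ - ∫ t, t ^ k ∂ν) ^ 2 / ((v : ℝ) ^ k * k.factorial) := by ring
    _ ≤ _ := ?_
  rcases le_or_gt k K with hk | hk
  · rw [hmom k hk]
    simp only [sub_self, ne_eq, OfNat.ofNat_ne_zero, not_false_eq_true, zero_pow, zero_div]
    positivity
  · have h4 : (4 : ℝ) ^ (K + 1) ≤ 4 ^ k := pow_le_pow_right₀ (by norm_num) hk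
    calc _ ≤ 4 * (M ^ 2) ^ k / ((v : ℝ) ^ k * k.factorial) := by
          gcongr
          exact sq_sub_moment_le hμ hν k
      _ = (M ^ 2 / v) ^ k / k.factorial / 4 ^ K * 4 ^ (K + 1) := by
          rw [div_pow]
          field_simp
          ring
      _ ≤ (M ^ 2 / v) ^ k / k.factorial / 4 ^ K * 4 ^ k := by gcongr
      _ = _ := by
          rw [mul_pow]
          ring

theorem integrable_gaussian_conv {v : ℝ≥0} (hv : v ≠ 0) {μ : Measure ℝ}
    [IsProbabilityMeasure μ] {M : ℝ} (hμ : ∀ᵐ t ∂μ, |t| ≤ M) (hM : 0 ≤ M) :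
    Integrable (fun x => ∫ t, gaussianPDFReal 0 v (x - t) ∂μ) ∧
      ∫ x, ∫ t, gaussianPDFReal 0 v (x - t) ∂μ = 1 := by
  have h0 : ∀ᵐ t ∂(Measure.dirac (0 : ℝ)), |t| ≤ M := by
    rw [ae_dirac_eq]
    simpa using hM
  obtain ⟨i, e⟩ := integral_gaussian_conv_mul_conv_div hv hμ h0
  have hcancel (x : ℝ) : (∫ t, gaussianPDFReal 0 v (x - t) ∂μ) *
      gaussianPDFReal 0 v x / gaussianPDFReal 0 v x = ∫ t, gaussianPDFReal 0 v (x - t) ∂μ :=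
    mul_div_cancel_right₀ _ (gaussianPDFReal_pos 0 v x hv).ne'
  simp only [integral_dirac, sub_zero, hcancel, Measure.prod_dirac] at i e
  refine ⟨i, e.trans ?_⟩
  rw [integral_map (by fun_prop) (by fun_prop)]
  simp

/-- The chi-square divergence between product densities. -/
theorem integral_sq_prod_div_prod_sub_one {d : ℕ} {g h : ℝ → ℝ} (hpos : ∀ x, 0 < h x)
    (hh : Integrable h) (hg : Integrable g) (hh1 : ∫ x, h x = 1) (hg1 : ∫ x, g x = 1)
    (hgh : Integrable fun x => (g x - h x) ^ 2 / h x) :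
    ∫ y : Fin d → ℝ, ((∏ i, g (y i)) / (∏ i, h (y i)) - 1) ^ 2
        ∂(volume.withDensity fun y => ENNReal.ofReal (∏ i, h (y i)))
      = (1 + ∫ x, (g x - h x) ^ 2 / h x) ^ d - 1 := by
  have hsq (x : ℝ) : g x ^ 2 / h x = (g x - h x) ^ 2 / h x - (-2) * g x + -h x := by
    have := (hpos x).ne'
    field_simp
    ring
  have hgg : Integrable fun x => g x ^ 2 / h x := by
    simp only [hsq]
    exact (hgh.sub (hg.const_mul (-2))).add hh.neg
  have hgg1 : ∫ x, g x ^ 2 / h x = 1 + ∫ x, (g x - h x) ^ 2 / h x := by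
    simp only [hsq]
    rw [integral_sub_const_mul_add hgh hg hh.fun_neg, integral_neg, hg1, hh1]
    ring
  have ih : Integrable fun y : Fin d → ℝ => ∏ i, h (y i) := Integrable.fintype_prod fun _ => hh
  have ig : Integrable fun y : Fin d → ℝ => ∏ i, g (y i) := Integrable.fintype_prod fun _ => hg
  have igg : Integrable fun y : Fin d → ℝ => ∏ i, (g (y i) ^ 2 / h (y i)) :=
    Integrable.fintype_prod (f := fun _ x => g x ^ 2 / h x) fun _ => hgg
  have hP (y : Fin d → ℝ) : 0 < ∏ i, h (y i) := Finset.prod_pos fun i _ => hpos _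
  rw [integral_withDensity_eq_integral_toReal_smul₀ ih.aemeasurable.ennreal_ofReal
    (.of_forall fun _ => ENNReal.ofReal_lt_top)]
  have hrw (y : Fin d → ℝ) : (ENNReal.ofReal (∏ i, h (y i))).toReal •
      ((∏ i, g (y i)) / (∏ i, h (y i)) - 1) ^ 2
      = ∏ i, (g (y i) ^ 2 / h (y i)) - 2 * ∏ i, g (y i) + ∏ i, h (y i) := by
    have := (hP y).ne'
    rw [ENNReal.toReal_ofReal (hP y).le, smul_eq_mul, Finset.prod_div_distrib, Finset.prod_pow]
    field_simp
    ring
  simp only [hrw]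
  rw [integral_sub_const_mul_add igg ig ih, integral_fintype_prod_volume_eq_pow (fun x => g x ^ 2 / h x),
    integral_fintype_prod_volume_eq_pow g, integral_fintype_prod_volume_eq_pow h,
    hgg1, hg1, hh1]
  simp only [Fintype.card_fin, one_pow]
  ring

theorem exp_half_mul_exp_mul_exp_div_four_pow_lt {L : ℝ} (hL : log 4 ≤ L) {K : ℕ}
    (hK : 3 / 2 * exp 1 * L ≤ K) :
    exp (exp L / 2 * (exp (4 * L) / 4 ^ K)) < 5 / 4 := by
  have hlog4 : (1.386 : ℝ) < log 4 := by
    have : log 4 = 2 * log 2 := by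
      rw [show (4 : ℝ) = 2 ^ 2 by norm_num, log_pow]
      norm_num
    linarith [log_two_gt_d9]
  have hpow : (4 : ℝ) ^ K = exp (K * log 4) := by
    rw [mul_comm, exp_mul, exp_log (by norm_num), rpow_natCast]
  have hKL : 5.65 * L ≤ K * log 4 := by
    have he : (4.077 : ℝ) ≤ 3 / 2 * exp 1 := by linarith [exp_one_gt_d9]
    have h1 : 4.077 * L ≤ K := le_trans (by gcongr; linarith) hK
    nlinarith
  have hsmall : exp L / 2 * (exp (4 * L) / 4 ^ K) ≤ 0.204 := by
    have h9 : (2.453 : ℝ) ≤ exp 0.9 := by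
      refine le_trans ?_ (sum_le_exp_of_nonneg (by norm_num) 5)
      norm_num [Finset.sum_range_succ, Nat.factorial]
    calc exp L / 2 * (exp (4 * L) / 4 ^ K) = exp (L + 4 * L - K * log 4) / 2 := by
          rw [hpow, exp_sub, exp_add]
          ring
      _ ≤ exp (-0.9) / 2 := by
          gcongr
          linarith
      _ = (exp 0.9)⁻¹ / 2 := by rw [exp_neg]
      _ ≤ (2.453)⁻¹ / 2 := by gcongr
      _ ≤ 0.204 := by norm_num
  have hhalf : exp (-0.102) ≥ 0.898 := by linarith [add_one_le_exp (-0.102 : ℝ)]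
  calc _ ≤ exp 0.204 := exp_le_exp.2 hsmall
    _ = (exp (-0.102))⁻¹ ^ 2 := by
      rw [← exp_neg, ← exp_nat_mul]
      norm_num
    _ ≤ (0.898)⁻¹ ^ 2 := by gcongr
    _ < 5 / 4 := by norm_num

/-- Lemma 7 (chi-square divergence bound between the two mixture priors). Let
`1 ≤ s ≤ d` with `s² ≥ 4d`, `ε > 0`, `Λ = √(log(s²/d))`, `M = εΛ`, and let `K` be the
smallest even integer with `K ≥ (3/2) e log(s²/d)`. Let `μ̃₀, μ̃₁` be probability
measures supported on `[−M, M]` whose moments of orders `0, …, K` coincide. With `φ` the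
`N(0, ε²)` density, `φ_i = φ * μ̃_i` (convolution), `h = (s/2d) φ₀ + (1 − s/2d) φ` and
`g = (s/2d) φ₁ + (1 − s/2d) φ`, the chi-square divergence between the `d`-fold product
measures `ℙ₁, ℙ₀` (with densities `∏ g(x_i)` and `∏ h(x_i)`) satisfies
`χ²(ℙ₁, ℙ₀) = (1 + ∫ (g − h)²/h)^d − 1 < 1/4`. -/
theorem chi_square_product_mixture_bound (d s : ℕ) (hs1 : 1 ≤ s) (hsd : s ≤ d)
    (hdense : 4 * d ≤ s ^ 2) (ε : ℝ) (hε : 0 < ε) (M : ℝ)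
    (hM : M = ε * Real.sqrt (Real.log ((s : ℝ) ^ 2 / d))) (K : ℕ) (hKeven : Even K)
    (hKge : (3 / 2 : ℝ) * Real.exp 1 * Real.log ((s : ℝ) ^ 2 / d) ≤ K)
    (hKmin : ∀ K' : ℕ, Even K' →
      (3 / 2 : ℝ) * Real.exp 1 * Real.log ((s : ℝ) ^ 2 / d) ≤ K' → K ≤ K')
    (μ0 μ1 : Measure ℝ) (h0 : IsProbabilityMeasure μ0) (h1 : IsProbabilityMeasure μ1)
    (hs0 : μ0 (Set.Icc (-M) M)ᶜ = 0) (hs1' : μ1 (Set.Icc (-M) M)ᶜ = 0)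
    (hmom : ∀ l : ℕ, l ≤ K → ∫ t, t ^ l ∂μ0 = ∫ t, t ^ l ∂μ1) :
    let φ : ℝ → ℝ := gaussianPDFReal 0 (ε ^ 2).toNNReal
    let h : ℝ → ℝ := fun x =>
      (s / (2 * d) : ℝ) * ∫ t, φ (x - t) ∂μ0 + (1 - s / (2 * d) : ℝ) * φ x
    let g : ℝ → ℝ := fun x =>
      (s / (2 * d) : ℝ) * ∫ t, φ (x - t) ∂μ1 + (1 - s / (2 * d) : ℝ) * φ x
    let P0 : Measure (Fin d → ℝ) :=
      (volume : Measure (Fin d → ℝ)).withDensity fun y => ENNReal.ofReal (∏ i, h (y i))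
    (∫ y, ((∏ i, g (y i)) / (∏ i, h (y i)) - 1) ^ 2 ∂P0
        = (1 + ∫ x, (g x - h x) ^ 2 / h x) ^ d - 1) ∧
      (1 + ∫ x, (g x - h x) ^ 2 / h x) ^ d - 1 < 1 / 4 := by
  intro φ h g P0
  have hd : 0 < (d : ℝ) := by exact_mod_cast hs1.trans hsd
  have hs : 0 < (s : ℝ) := by exact_mod_cast hs1
  have hsd' : (s : ℝ) ≤ d := by exact_mod_cast hsd
  have hr4 : 4 ≤ (s : ℝ) ^ 2 / d := by
    rw [le_div_iff₀ hd]
    exact_mod_cast hdense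
  set L : ℝ := log ((s : ℝ) ^ 2 / d) with hLdef
  have hL4 : log 4 ≤ L := log_le_log (by norm_num) hr4
  have hL0 : 0 ≤ L := (log_nonneg (by norm_num)).trans hL4
  have hexpL : exp L = (s : ℝ) ^ 2 / d := exp_log (by linarith)
  have hM0 : 0 ≤ M := hM ▸ mul_nonneg hε.le (sqrt_nonneg _)
  have hv : (ε ^ 2).toNNReal ≠ 0 := by
    rw [ne_eq, Real.toNNReal_eq_zero, not_le]
    positivity
  have hML : M ^ 2 / ((ε ^ 2).toNNReal : ℝ) = L := by
    rw [Real.coe_toNNReal _ (sq_nonneg ε), hM, mul_pow, sq_sqrt hL0]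
    field_simp
  have ha0 := ae_abs_le_of_measure_Icc_compl hs0
  have ha1 := ae_abs_le_of_measure_Icc_compl hs1'
  obtain ⟨i0, e0⟩ := integrable_gaussian_conv hv ha0 hM0
  obtain ⟨i1, e1⟩ := integrable_gaussian_conv hv ha1 hM0
  obtain ⟨iq, eq⟩ := integral_sq_sub_gaussian_conv_div_le hv ha1 ha0
    fun l hl => (hmom l hl).symm
  rw [hML] at eq
  have iφ : Integrable φ := integrable_gaussianPDFReal _ _
  have eφ : ∫ x, φ x = 1 := integral_gaussianPDFReal_eq_one _ hv
  have hφ (x : ℝ) : 0 < φ x := gaussianPDFReal_pos _ _ x hv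
  set c : ℝ := s / (2 * d) with hc
  have hc0 : 0 ≤ c := by positivity
  have hc2 : c ≤ 1 / 2 := by
    rw [hc, div_le_iff₀ (by positivity)]
    linarith
  have ih : Integrable h := (i0.const_mul c).add (iφ.const_mul (1 - c))
  have ig : Integrable g := (i1.const_mul c).add (iφ.const_mul (1 - c))
  have eh : ∫ x, h x = 1 := by
    simp only [h]
    rw [integral_add (i0.const_mul c) (iφ.const_mul (1 - c)), integral_const_mul,
      integral_const_mul, e0, eφ]
    ring
  have eg : ∫ x, g x = 1 := by
    simp only [g]
    rw [integral_add (i1.const_mul c) (iφ.const_mul (1 - c)), integral_const_mul,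
      integral_const_mul, e1, eφ]
    ring
  have hhφ (x : ℝ) : φ x / 2 ≤ h x := by
    have h1 : 0 ≤ c * ∫ t, φ (x - t) ∂μ0 :=
      mul_nonneg hc0 (integral_nonneg fun t => (hφ _).le)
    have h2 : φ x / 2 ≤ (1 - c) * φ x := by nlinarith [hφ x]
    simp only [h]
    linarith
  have hpos (x : ℝ) : 0 < h x := (half_pos (hφ x)).trans_le (hhφ x)
  have hle (x : ℝ) : (g x - h x) ^ 2 / h x ≤ 2 * c ^ 2 *
      (((∫ t, φ (x - t) ∂μ1) - ∫ t, φ (x - t) ∂μ0) ^ 2 / φ x) := by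
    calc (g x - h x) ^ 2 / h x ≤ (g x - h x) ^ 2 / (φ x / 2) :=
          div_le_div_of_nonneg_left (sq_nonneg _) (half_pos (hφ x)) (hhφ x)
      _ = _ := by
          have hsub : g x - h x = c * ((∫ t, φ (x - t) ∂μ1) - ∫ t, φ (x - t) ∂μ0) := by
            simp only [g, h, hc]
            ring
          rw [hsub]
          ring
  have hnn (x : ℝ) : 0 ≤ (g x - h x) ^ 2 / h x := div_nonneg (sq_nonneg _) (hpos x).le
  have igh : Integrable fun x => (g x - h x) ^ 2 / h x := by
    refine (iq.const_mul (2 * c ^ 2)).mono'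
      (((ig.sub ih).aemeasurable.pow_const 2).div ih.aemeasurable).aestronglyMeasurable
      (.of_forall fun x => ?_)
    rw [norm_of_nonneg (hnn x)]
    exact hle x
  refine ⟨integral_sq_prod_div_prod_sub_one hpos ih ig eh eg igh, ?_⟩
  have hI0 : 0 ≤ ∫ x, (g x - h x) ^ 2 / h x := integral_nonneg hnn
  have hI : ∫ x, (g x - h x) ^ 2 / h x ≤ 2 * c ^ 2 * (exp (4 * L) / 4 ^ K) := by
    refine (integral_mono igh (iq.const_mul (2 * c ^ 2)) hle).trans ?_
    rw [integral_const_mul]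
    gcongr
  have hdI : d * ∫ x, (g x - h x) ^ 2 / h x ≤ exp L / 2 * (exp (4 * L) / 4 ^ K) := by
    calc d * ∫ x, (g x - h x) ^ 2 / h x ≤ d * (2 * c ^ 2 * (exp (4 * L) / 4 ^ K)) := by gcongr
      _ = _ := by
          rw [hexpL, hc]
          field_simp
  have hfin : (1 + ∫ x, (g x - h x) ^ 2 / h x) ^ d < 5 / 4 := by
    calc (1 + ∫ x, (g x - h x) ^ 2 / h x) ^ d ≤ exp (∫ x, (g x - h x) ^ 2 / h x) ^ d := by
          gcongr
          linarith [add_one_le_exp (∫ x, (g x - h x) ^ 2 / h x)]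
      _ = exp (d * ∫ x, (g x - h x) ^ 2 / h x) := by rw [exp_nat_mul]
      _ ≤ exp (exp L / 2 * (exp (4 * L) / 4 ^ K)) := exp_le_exp.2 hdI
      _ < 5 / 4 := exp_half_mul_exp_mul_exp_div_four_pow_lt hL4 hKge
  linarith
end

section
/- Let d, s be integers with 1 ≤ s ≤ d, and let X be a random variable with the binomial distribution with d trials and success probability s/(2d). Then P(X > s) ≤ e^{−s/16}. -/
/-- Chernoff's bound for the upper tail of the binomial distribution with `n` trials and success
probability `p`, with a free parameter `t ≥ 1`. -/
theorem binomial_upper_tail_le {p t : ℝ} (hp0 : 0 ≤ p) (hp1 : p ≤ 1) (ht : 1 ≤ t) (n m : ℕ) :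
    ∑ k ∈ Finset.Icc (m + 1) n, (n.choose k : ℝ) * p ^ k * (1 - p) ^ (n - k)
      ≤ Real.exp ((t - 1) * p * n) / t ^ m := by
  have hq : 0 ≤ 1 - p := sub_nonneg.2 hp1
  have ht0 : 0 < t := by linarith
  rw [le_div_iff₀ (by positivity), Finset.sum_mul]
  calc
    _ ≤ ∑ k ∈ Finset.Icc (m + 1) n, (t * p) ^ k * (1 - p) ^ (n - k) * (n.choose k : ℝ) := by
      refine Finset.sum_le_sum fun k hk => ?_
      have hmk : m ≤ k := (Nat.le_succ m).trans (Finset.mem_Icc.1 hk).1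
      calc
        _ ≤ (n.choose k : ℝ) * p ^ k * (1 - p) ^ (n - k) * t ^ k := by gcongr
        _ = _ := by rw [mul_pow]; ring
    _ ≤ ∑ k ∈ Finset.range (n + 1), (t * p) ^ k * (1 - p) ^ (n - k) * (n.choose k : ℝ) := by
      refine Finset.sum_le_sum_of_subset_of_nonneg (fun k hk => ?_) fun k _ _ => by positivity
      exact Finset.mem_range.2 (Nat.lt_succ_of_le (Finset.mem_Icc.1 hk).2)
    _ = ((t - 1) * p + 1) ^ n := by rw [← add_pow]; ring
    _ ≤ Real.exp ((t - 1) * p) ^ n := by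
      have : 0 ≤ (t - 1) * p := mul_nonneg (sub_nonneg.2 ht) hp0
      gcongr
      exact Real.add_one_le_exp _
    _ = Real.exp ((t - 1) * p * n) := by rw [← Real.exp_nat_mul]; ring_nf

/-- Lemma 5 (binomial tail bound). If `1 ≤ s ≤ d` and `X` has the binomial distribution
with `d` trials and success probability `s/(2d)`, then `P(X > s) ≤ e^{−s/16}`. The
probability `P(X > s)` is written explicitly as
`Σ_{k=s+1}^{d} C(d,k) (s/(2d))^k (1 − s/(2d))^{d−k}`. -/
theorem binomial_tail_bound (d s : ℕ) (hs1 : 1 ≤ s) (hsd : s ≤ d) :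
    ∑ k ∈ Finset.Icc (s + 1) d,
        (d.choose k : ℝ) * ((s : ℝ) / (2 * d)) ^ k *
          (1 - (s : ℝ) / (2 * d)) ^ (d - k)
      ≤ Real.exp (-(s : ℝ) / 16) := by
  have hs : (1 : ℝ) ≤ s := by exact_mod_cast hs1
  have hd : (s : ℝ) ≤ d := by exact_mod_cast hsd
  have hd0 : (0 : ℝ) < d := by linarith
  have hp1 : (s : ℝ) / (2 * d) ≤ 1 := by
    rw [div_le_one (by positivity)]
    linarith
  refine (binomial_upper_tail_le (by positivity) hp1 one_le_two d s).trans ?_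
  have hmean : (2 - 1) * ((s : ℝ) / (2 * d)) * d = s / 2 := by
    field_simp
    norm_num
  have hpow : (2 : ℝ) ^ s = Real.exp (s * Real.log 2) := by
    rw [Real.exp_nat_mul, Real.exp_log two_pos]
  rw [hmean, hpow, ← Real.exp_sub]
  gcongr
  nlinarith [Real.log_two_gt_d9]
end
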